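/- For all W_1, W_2 ∈ A, the number of 1-dimensional subspaces contained in W_1 ∩ W_2 equals |φ(W_1) ∩ φ(W_2)|, where φ(W) = [σ(W ∩ H)] ∪ ([W] \ [H]) for W ∈ A. -/

import Mathlib

/-- `[W]`: the set of `1`-dimensional subspaces of `V` contained in `W`. -/
def projPts {F V : Type*} [Field F] [AddCommGroup V] [Module F V]
    (W : Submodule F V) : Set (Submodule F V) :=
  {L | Module.finrank F ↥L = 1 ∧ L ≤ W}

/-- `φ(W) = [σ(W ∩ H)] ∪ ([W] \ [H])` for `W ∈ A`, where `σ` is a polarity of the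
hyperplane `H`. -/
def phiA {F V : Type*} [Field F] [AddCommGroup V] [Module F V]
    (H : Submodule F V) (σ : Submodule F ↥H → Submodule F ↥H)
    (W : Submodule F V) : Set (Submodule F V) :=
  projPts (Submodule.map H.subtype (σ (Submodule.comap H.subtype W))) ∪
    (projPts W \ projPts H)

theorem aux_strict {F M : Type*} [Field F] [AddCommGroup M] [Module F M] [FiniteDimensional F M]
    (σ : Submodule F M → Submodule F M)
    (hs : ∀ U U' : Submodule F M, U < U' → σ U' < σ U) (k : ℕ) :
    ∀ U U' : Submodule F M, U ≤ U' → Module.finrank F U' = Module.finrank F U + k →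
      Module.finrank F (σ U') + k ≤ Module.finrank F (σ U) := by
  induction k with
  | zero =>
    intro U U' h hk
    rw [Submodule.eq_of_le_of_finrank_eq h (by omega)]
    simp
  | succ k ih =>
    intro U U' h hk
    have hlt : U < U' := lt_of_le_of_ne h (by rintro rfl; omega)
    obtain ⟨v, hv, hvU⟩ := SetLike.exists_of_lt hlt
    have h1 : U < U ⊔ Submodule.span F {v} := by
      refine lt_of_le_of_ne le_sup_left fun he => hvU ?_
      rw [he]
      exact (le_sup_right : Submodule.span F {v} ≤ _) (Submodule.mem_span_singleton_self v)
    have h2 : U ⊔ Submodule.span F {v} ≤ U' :=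
      sup_le h ((Submodule.span_singleton_le_iff_mem _ _).2 hv)
    have h3 := Submodule.finrank_lt_finrank_of_lt h1
    have h4 := Submodule.finrank_add_le_finrank_add_finrank U (Submodule.span F {v})
    have h5 : Module.finrank F (Submodule.span F {v}) = 1 :=
      finrank_span_singleton (by rintro rfl; exact hvU U.zero_mem)
    have h6 := ih _ _ h2 (by omega)
    have h7 := Submodule.finrank_lt_finrank_of_lt (hs _ _ h1)
    omega

theorem aux_polarity {F M : Type*} [Field F] [AddCommGroup M] [Module F M] [FiniteDimensional F M]
    (σ : Submodule F M → Submodule F M)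
    (hinv : ∀ U, σ (σ U) = U)
    (hanti : ∀ U U' : Submodule F M, U ≤ U' → σ U' ≤ σ U) (U : Submodule F M) :
    Module.finrank F (σ U) + Module.finrank F U = Module.finrank F M := by
  have hs : ∀ U U' : Submodule F M, U < U' → σ U' < σ U := by
    intro U U' h
    refine lt_of_le_of_ne (hanti _ _ h.le) fun he => h.ne ?_
    rw [← hinv U, ← hinv U', he]
  have hU := Submodule.finrank_le U
  have h1 := aux_strict σ hs (Module.finrank F U) ⊥ U bot_le (by simp)
  have h2 := aux_strict σ hs (Module.finrank F M - Module.finrank F U) U ⊤ le_top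
    (by rw [finrank_top]; omega)
  have h3 := Submodule.finrank_le (σ ⊥)
  omega

theorem projPts_eq_image {F V : Type*} [Field F] [AddCommGroup V] [Module F V]
    (W : Submodule F V) :
    projPts W = Submodule.map W.subtype '' {L | Module.finrank F L = 1} := by
  ext L
  constructor
  · rintro ⟨h1, h2⟩
    refine ⟨Submodule.comap W.subtype L, ?_, ?_⟩
    · show Module.finrank F _ = 1
      rw [← h1]
      exact (Submodule.comapSubtypeEquivOfLe h2).finrank_eq
    · rw [Submodule.map_comap_subtype, inf_eq_right.2 h2]
  · rintro ⟨L, hL, rfl⟩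
    refine ⟨?_, Submodule.map_subtype_le _ _⟩
    rw [Submodule.finrank_map_subtype_eq]
    exact hL

theorem ncard_projPts {F V : Type*} [Field F] [AddCommGroup V] [Module F V]
    [FiniteDimensional F V] (W W' : Submodule F V)
    (h : Module.finrank F W = Module.finrank F W') :
    (projPts W).ncard = (projPts W').ncard := by
  rw [projPts_eq_image, projPts_eq_image,
    Set.ncard_image_of_injective _ (Submodule.map_injective_of_injective W.injective_subtype),
    Set.ncard_image_of_injective _ (Submodule.map_injective_of_injective W'.injective_subtype)]
  let f : W ≃ₗ[F] W' := LinearEquiv.ofFinrankEq _ _ h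
  have hf : Function.Injective (Submodule.map (f : W →ₗ[F] W')) :=
    Submodule.map_injective_of_injective f.injective
  rw [← Set.ncard_image_of_injective _ hf]
  congr 1
  ext L
  constructor
  · rintro ⟨L, hL, rfl⟩
    exact (LinearEquiv.finrank_map_eq f L).trans hL
  · intro hL
    refine ⟨Submodule.map (f.symm : W' →ₗ[F] W) L, (LinearEquiv.finrank_map_eq f.symm L).trans hL, ?_⟩
    rw [← Submodule.map_comp]
    simp

/-- For all `W₁, W₂ ∈ A = {W ∈ Gr_{e+1}(V) : W ⊄ H}`, the number of
`1`-dimensional subspaces contained in `W₁ ∩ W₂` equals `|φ(W₁) ∩ φ(W₂)|`, where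
`φ(W) = [σ(W ∩ H)] ∪ ([W] \ [H])`. -/
theorem stmt_15 {F : Type*} [Field F] [Fintype F]
    {V : Type*} [AddCommGroup V] [Module F V] [FiniteDimensional F V]
    (e : ℕ) (he : 1 ≤ e) (hV : Module.finrank F V = 2 * e + 1)
    (H : Submodule F V) (hH : Module.finrank F ↥H = 2 * e)
    (σ : Submodule F ↥H → Submodule F ↥H)
    (hσinv : ∀ U, σ (σ U) = U)
    (hσanti : ∀ U U' : Submodule F ↥H, U ≤ U' → σ U' ≤ σ U)
    (W₁ W₂ : Submodule F V)
    (hW₁ : Module.finrank F ↥W₁ = e + 1 ∧ ¬ W₁ ≤ H)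
    (hW₂ : Module.finrank F ↥W₂ = e + 1 ∧ ¬ W₂ ≤ H) :
    (projPts (W₁ ⊓ W₂)).ncard = (phiA H σ W₁ ∩ phiA H σ W₂).ncard := by
  have hfin : Finite V := Module.finite_of_finite F
  have hfinS : Finite (Submodule F V) :=
    Finite.of_injective (fun S : Submodule F V => (S : Set V)) SetLike.coe_injective
  have key : ∀ W : Submodule F V, Module.finrank F W = e + 1 ∧ ¬ W ≤ H →
      Module.finrank F (Submodule.comap H.subtype W) = e := by
    rintro W ⟨h1, h2⟩
    have h3 : Module.finrank F (Submodule.comap H.subtype W) = Module.finrank F ↥(H ⊓ W) := by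
      rw [← Submodule.map_comap_subtype, Submodule.finrank_map_subtype_eq]
    have h4 := Submodule.finrank_sup_add_finrank_inf_eq H W
    have h5 : H < H ⊔ W := lt_of_le_of_ne le_sup_left fun he => h2 (he ▸ le_sup_right)
    have h6 := Submodule.finrank_lt_finrank_of_lt h5
    have h7 := Submodule.finrank_le (H ⊔ W)
    omega
  set U₁ := Submodule.comap H.subtype W₁ with hU₁
  set U₂ := Submodule.comap H.subtype W₂ with hU₂
  have k1 : Module.finrank F U₁ = e := key W₁ hW₁
  have k2 : Module.finrank F U₂ = e := key W₂ hW₂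
  have hsup : σ (U₁ ⊔ U₂) = σ U₁ ⊓ σ U₂ := by
    apply le_antisymm
    · exact le_inf (hσanti _ _ le_sup_left) (hσanti _ _ le_sup_right)
    · rw [← hσinv (σ U₁ ⊓ σ U₂)]
      apply hσanti
      refine sup_le ?_ ?_
      · conv_lhs => rw [← hσinv U₁]
        exact hσanti _ _ inf_le_left
      · conv_lhs => rw [← hσinv U₂]
        exact hσanti _ _ inf_le_right
  have hdim : Module.finrank F ↥(U₁ ⊓ U₂) = Module.finrank F ↥(σ U₁ ⊓ σ U₂) := by
    rw [← hsup]
    have h1 := aux_polarity σ hσinv hσanti (U₁ ⊔ U₂)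
    have h2 := Submodule.finrank_sup_add_finrank_inf_eq U₁ U₂
    omega
  have hL : projPts (W₁ ⊓ W₂) = projPts (Submodule.map H.subtype (U₁ ⊓ U₂)) ∪
      (projPts (W₁ ⊓ W₂) \ projPts H) := by
    have : Submodule.map H.subtype (U₁ ⊓ U₂) = H ⊓ (W₁ ⊓ W₂) := by
      rw [hU₁, hU₂, ← Submodule.comap_inf, Submodule.map_comap_subtype]
    rw [this]
    ext L
    simp only [projPts, Set.mem_union, Set.mem_diff, Set.mem_setOf_eq, le_inf_iff]
    tauto
  have hR : phiA H σ W₁ ∩ phiA H σ W₂ = projPts (Submodule.map H.subtype (σ U₁ ⊓ σ U₂)) ∪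
      (projPts (W₁ ⊓ W₂) \ projPts H) := by
    rw [Submodule.map_inf _ H.injective_subtype]
    ext L
    have a1 : L ≤ Submodule.map H.subtype (σ U₁) → L ≤ H :=
      fun h => h.trans (Submodule.map_subtype_le _ _)
    have a2 : L ≤ Submodule.map H.subtype (σ U₂) → L ≤ H :=
      fun h => h.trans (Submodule.map_subtype_le _ _)
    simp only [phiA, projPts, Set.mem_union, Set.mem_inter_iff, Set.mem_diff, Set.mem_setOf_eq,
      le_inf_iff, ← hU₁, ← hU₂]
    tauto
  have hdisj : ∀ U : Submodule F H, Disjoint (projPts (Submodule.map H.subtype U))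
      (projPts (W₁ ⊓ W₂) \ projPts H) := by
    intro U
    rw [Set.disjoint_left]
    rintro L ⟨h1, h2⟩ ⟨_, h3⟩
    exact h3 ⟨h1, h2.trans (Submodule.map_subtype_le _ _)⟩
  rw [hR, hL, Set.ncard_union_eq (hdisj _) (Set.toFinite _) (Set.toFinite _),
    ← hL, Set.ncard_union_eq (hdisj _) (Set.toFinite _) (Set.toFinite _)]
  congr 1
  apply ncard_projPts
  rw [Submodule.finrank_map_subtype_eq, Submodule.finrank_map_subtype_eq, hdim]
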